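/- Let k be an algebraically closed field whose characteristic does not divide d(d−1), with d ≥ 3, V a finite-dimensional k-vector space, and f a nonzero homogeneous polynomial of degree d on V. Then there is a nonempty Zariski open subset of V such that for every v in it, rk^S(∂_v f) ≥ 2^{2−d}·rk^S(f), where ∂_v f denotes the directional derivative of f along v (a homogeneous polynomial of degree d−1). -/

import Mathlib

open MvPolynomial

/-- The Schmidt rank (strength) of a polynomial: the smallest `r` such that
`f = ∑ i : Fin r, g i * h i` with all `g i`, `h i` homogeneous of positive degree. -/
noncomputable def polySchmidtRank {k : Type} [Field k] {σ : Type} (f : MvPolynomial σ k) : ℕ :=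
  sInf {r | ∃ g h : Fin r → MvPolynomial σ k,
    (∀ i, ∃ a, 0 < a ∧ (g i).IsHomogeneous a) ∧
    (∀ i, ∃ b, 0 < b ∧ (h i).IsHomogeneous b) ∧
    f = ∑ i, g i * h i}

/-- The ideal of polynomials without constant term has height at least the number of variables. -/
theorem le_height_ker_constantCoeff {E : Type*} [Field E] (n : ℕ) :
    (n : ℕ∞) ≤ (RingHom.ker (constantCoeff : MvPolynomial (Fin n) E →+* E)).height := by
  classical
  let φ : ℕ → MvPolynomial (Fin n) E →ₐ[E] MvPolynomial (Fin n) E := fun j =>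
    aeval fun i => if (i : ℕ) < j then 0 else X i
  have hP : ∀ j, (RingHom.ker (φ j)).IsPrime := fun j => RingHom.ker_isPrime _
  have hcomp : ∀ j, (φ (j + 1)).comp (φ j) = φ (j + 1) := by
    intro j
    ext1 i
    by_cases h : (i : ℕ) < j
    · have : (i : ℕ) < j + 1 := by omega
      simp only [φ, AlgHom.comp_apply, aeval_X, h, this, if_true, map_zero]
    · simp [φ, h]
  have hlt : ∀ j, j < n → RingHom.ker (φ j) < RingHom.ker (φ (j + 1)) := by
    intro j hj
    refine lt_of_le_of_ne ?_ ?_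
    · intro p hp
      rw [RingHom.mem_ker] at hp ⊢
      rw [← hcomp j, AlgHom.comp_apply, hp, map_zero]
    · intro h
      have h1 : (X ⟨j, hj⟩ : MvPolynomial (Fin n) E) ∈ RingHom.ker (φ (j + 1)) := by
        simp [RingHom.mem_ker, φ]
      rw [← h] at h1
      simp [RingHom.mem_ker, φ] at h1
  have key : ∀ j, j ≤ n → (j : ℕ∞) ≤ (RingHom.ker (φ j)).height := by
    intro j
    induction j with
    | zero => simp
    | succ j ih =>
      intro hj
      have := hP j
      have := hP (j + 1)
      have h1 := Ideal.height_add_one_le_of_lt_of_isPrime (hlt j hj)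
      refine le_trans ?_ h1
      push_cast
      gcongr
      exact ih (by omega)
  have hn : RingHom.ker (φ n) ≤ RingHom.ker (constantCoeff : MvPolynomial (Fin n) E →+* E) := by
    intro p hp
    have : ∀ q, constantCoeff (φ n q) = constantCoeff q := by
      intro q
      simp only [φ, Fin.is_lt, if_true]
      induction q using MvPolynomial.induction_on with
      | C a => simp
      | add p q hp hq => rw [map_add, map_add, map_add, hp, hq]
      | mul_X p i hp => simp
    rw [RingHom.mem_ker] at hp ⊢
    rw [← this, hp, map_zero]
  exact (key n le_rfl).trans (Ideal.height_mono hn)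

theorem ringKrullDim_le_of_isIntegral {A B : Type*} [CommRing A] [CommRing B] [Algebra A B]
    [Algebra.IsIntegral A B] : ringKrullDim B ≤ ringKrullDim A := by
  refine Order.krullDim_le_of_strictMono (PrimeSpectrum.comap (algebraMap A B)) ?_
  intro p q hpq
  exact Ideal.IsIntegral.comap_lt_comap hpq

theorem exists_zero_of_constantCoeff_eq_zero {E : Type} [Field E] {n c : ℕ}
    (g : Fin c → MvPolynomial (Fin n) E) (hg : ∀ i, constantCoeff (g i) = 0) :
    ∃ (L : Type) (_ : Field L) (_ : Algebra E L) (x : Fin n → L),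
      (∀ i, aeval x (g i) = 0) ∧
      ∃ t : Set (Fin n), AlgebraicIndependent E (fun i : t => x i) ∧ n ≤ t.ncard + c := by
  classical
  set I : Ideal (MvPolynomial (Fin n) E) := Ideal.span (Set.range g) with hI
  have hsub : Set.range g ⊆ RingHom.ker (constantCoeff : MvPolynomial (Fin n) E →+* E) := by
    rintro _ ⟨i, rfl⟩
    exact hg i
  have hprime : (RingHom.ker (constantCoeff : MvPolynomial (Fin n) E →+* E)).IsPrime :=
    RingHom.ker_isPrime _
  have hItop : I ≠ ⊤ := fun h => hprime.ne_top <| top_le_iff.1 <| h ▸ Ideal.span_le.2 hsub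
  have hdim := Ideal.height_le_ringKrullDim_quotient_add_encard (Set.range g) hsub
  obtain ⟨s, -, φ, hφ, hint⟩ := exists_integral_inj_algHom_of_quotient I hItop
  let := φ.toRingHom.toAlgebra
  have : Algebra.IsIntegral (MvPolynomial (Fin s) E) (MvPolynomial (Fin n) E ⧸ I) := ⟨hint⟩
  have : IsScalarTower E (MvPolynomial (Fin s) E) (MvPolynomial (Fin n) E ⧸ I) :=
    IsScalarTower.of_algebraMap_eq' φ.comp_algebraMap.symm
  have h1 := ringKrullDim_le_of_isIntegral (A := MvPolynomial (Fin s) E)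
    (B := MvPolynomial (Fin n) E ⧸ I)
  rw [MvPolynomial.ringKrullDim_of_isNoetherianRing, ringKrullDim_eq_zero_of_field] at h1
  have hns : n ≤ s + c := by
    have h2 := le_height_ker_constantCoeff (E := E) n
    have h3 : (Set.range g).encard ≤ c := by
      rw [← Set.image_univ]
      refine (Set.encard_image_le _ _).trans ?_
      simp
    have h4 : ((n : ℕ∞) : WithBot ℕ∞) ≤ ((s : ℕ∞) : WithBot ℕ∞) + ((c : ℕ∞) : WithBot ℕ∞) := by
      refine (WithBot.coe_le_coe.2 h2).trans (hdim.trans ?_)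
      refine add_le_add (h1.trans ?_) (WithBot.coe_le_coe.2 h3)
      simp
    exact_mod_cast h4
  obtain ⟨P, -, hPp, hP⟩ := Ideal.exists_ideal_over_prime_of_isIntegral
    (R := MvPolynomial (Fin s) E) (S := MvPolynomial (Fin n) E ⧸ I) ⊥ ⊥ (by
      intro p hp
      rw [Ideal.mem_comap, Ideal.mem_bot] at hp
      have : φ p = 0 := hp
      rw [map_eq_zero_iff _ hφ] at this
      simpa using this)
  let L := FractionRing ((MvPolynomial (Fin n) E ⧸ I) ⧸ P)
  let x : Fin n → L := fun i =>
    algebraMap ((MvPolynomial (Fin n) E ⧸ I) ⧸ P) L (Ideal.Quotient.mk P (Ideal.Quotient.mk I (X i)))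
  have hx : ∀ p : MvPolynomial (Fin n) E, aeval x p =
      algebraMap ((MvPolynomial (Fin n) E ⧸ I) ⧸ P) L
        (Ideal.Quotient.mk P (Ideal.Quotient.mk I p)) := by
    intro p
    let ψ : MvPolynomial (Fin n) E →ₐ[E] L :=
      (IsScalarTower.toAlgHom E ((MvPolynomial (Fin n) E ⧸ I) ⧸ P) L).comp
        ((Ideal.Quotient.mkₐ E P).comp (Ideal.Quotient.mkₐ E I))
    have : aeval x = ψ := by
      ext i
      simp [x, ψ]
    rw [this]
    rfl
  refine ⟨L, inferInstance, inferInstance, x, ?_, ?_⟩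
  · intro i
    have : Ideal.Quotient.mk I (g i) = 0 :=
      Ideal.Quotient.eq_zero_iff_mem.2 (Ideal.subset_span ⟨i, rfl⟩)
    rw [hx, this, map_zero, map_zero]
  · let χ : MvPolynomial (Fin s) E →ₐ[E] L :=
      (IsScalarTower.toAlgHom E ((MvPolynomial (Fin n) E ⧸ I) ⧸ P) L).comp
        ((Ideal.Quotient.mkₐ E P).comp φ)
    have hχ : Function.Injective χ := by
      rw [injective_iff_map_eq_zero]
      intro p hp
      have h5 : Ideal.Quotient.mk P (φ p) = 0 :=
        IsFractionRing.injective ((MvPolynomial (Fin n) E ⧸ I) ⧸ P) L (by simpa [χ] using hp)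
      have h6 : φ p ∈ P := Ideal.Quotient.eq_zero_iff_mem.1 h5
      change p ∈ P.comap (algebraMap (MvPolynomial (Fin s) E) (MvPolynomial (Fin n) E ⧸ I)) at h6
      rw [hP] at h6
      simpa using h6
    have hz : AlgebraicIndependent E (fun j : Fin s => χ (X j)) := by
      rw [algebraicIndependent_iff_injective_aeval]
      have : aeval (fun j : Fin s => χ (X j)) = χ := by
        ext i
        simp
      rwa [this]
    have halg : Algebra.IsAlgebraic (Algebra.adjoin E (Set.range x)) L := by
      constructor
      intro y
      obtain ⟨a, b, hb, rfl⟩ := IsFractionRing.div_surjective ((MvPolynomial (Fin n) E ⧸ I) ⧸ P) y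
      have h7 : ∀ a : (MvPolynomial (Fin n) E ⧸ I) ⧸ P,
          IsAlgebraic (Algebra.adjoin E (Set.range x))
            (algebraMap ((MvPolynomial (Fin n) E ⧸ I) ⧸ P) L a) := by
        intro a
        obtain ⟨a, rfl⟩ := Ideal.Quotient.mk_surjective a
        obtain ⟨a, rfl⟩ := Ideal.Quotient.mk_surjective a
        rw [← hx]
        have h8 : aeval x a ∈ Algebra.adjoin E (Set.range x) := by
          rw [Algebra.adjoin_range_eq_range_aeval]
          exact ⟨a, rfl⟩
        exact isAlgebraic_algebraMap (⟨_, h8⟩ : Algebra.adjoin E (Set.range x))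
      rw [div_eq_mul_inv]
      exact (h7 a).mul (h7 b).inv
    have : FaithfulSMul E L :=
      (faithfulSMul_iff_algebraMap_injective E L).2 (algebraMap E L).injective
    obtain ⟨t', ht', hbasis⟩ := exists_isTranscendenceBasis_subset (R := E) (Set.range x)
    have hcard : (s : Cardinal) ≤ Cardinal.mk t' := by
      rw [hbasis.cardinalMk_eq_trdeg]
      simpa using hz.lift_cardinalMk_le_trdeg
    have hfin : t'.Finite := (Set.finite_range x).subset ht'
    obtain ⟨t, -, ht⟩ := Set.SurjOn.exists_bijOn_subset (f := x) (s := Set.univ) (t := t')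
      (fun y hy => by simpa using ht' hy)
    refine ⟨t, hbasis.1.comp (ht.equiv x) (Equiv.injective _), ?_⟩
    have h9 : s ≤ t'.ncard := by
      rw [← Set.cast_ncard hfin] at hcard
      exact_mod_cast hcard
    rw [← ht.image_eq, ht.injOn.ncard_image] at h9
    omega

theorem card_le_trdeg_add_of_mem_adjoin {k F L : Type} [Field k] [Field F] [Field L] [Algebra k F]
    [Algebra F L] [Algebra k L] [IsScalarTower k F L] {ι : Type} [Fintype ι] {m s : ℕ} {y : ι → L}
    (hy : AlgebraicIndependent k y) (hs : Algebra.trdeg k F = s) (w : Fin m → L)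
    (hyw : ∀ i, y i ∈ Algebra.adjoin F (Set.range w)) : Fintype.card ι ≤ s + m := by
  let B := Algebra.adjoin F (Set.range w)
  have hB : Algebra.trdeg F B ≤ m := by
    let φ : MvPolynomial (Fin m) F →ₐ[F] B :=
      aeval fun i => ⟨w i, Algebra.subset_adjoin (Set.mem_range_self i)⟩
    have hφ : Function.Surjective φ := by
      rintro ⟨b, hb⟩
      have hb' : b ∈ Algebra.adjoin F (Set.range w) := hb
      rw [Algebra.adjoin_range_eq_range_aeval] at hb'
      obtain ⟨p, rfl⟩ := hb'
      refine ⟨p, Subtype.ext ?_⟩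
      change B.val (φ p) = _
      rw [← AlgHom.comp_apply]
      congr 1
      ext i
      simp [φ]
    simpa using trdeg_le_of_surjective φ hφ
  have hFB : FaithfulSMul F B :=
    (faithfulSMul_iff_algebraMap_injective F B).2 (algebraMap F B).injective
  have hkF : FaithfulSMul k F :=
    (faithfulSMul_iff_algebraMap_injective k F).2 (algebraMap k F).injective
  have h1 := trdeg_add_eq k F (A := B)
  have hy' : AlgebraicIndependent k (fun i => (⟨y i, hyw i⟩ : B)) :=
    AlgebraicIndependent.of_comp (B.val.restrictScalars k) hy
  have h2 := hy'.cardinalMk_le_trdeg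
  rw [← h1, hs] at h2
  have h3 : ((Fintype.card ι : ℕ) : Cardinal) ≤ ((s + m : ℕ) : Cardinal) := by
    push_cast
    rw [← Cardinal.mk_fintype]
    exact h2.trans (by gcongr)
  exact_mod_cast h3

open Matrix in
theorem exists_rank_factorization {F : Type*} [Field F] {m n : ℕ} (H : Matrix (Fin m) (Fin n) F) :
    ∃ (P : Matrix (Fin m) (Fin H.rank) F) (Q : Matrix (Fin H.rank) (Fin n) F)
      (R : Matrix (Fin n) (Fin H.rank) F) (S : Matrix (Fin H.rank) (Fin m) F),
      H = P * Q ∧ Q * R = 1 ∧ S * P = 1 := by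
  let W := LinearMap.range H.mulVecLin
  have hW : Module.finrank F W = H.rank := rfl
  let e : W ≃ₗ[F] (Fin H.rank → F) := (Module.finBasisOfFinrankEq F W hW).equivFun
  let q : (Fin n → F) →ₗ[F] (Fin H.rank → F) := e.toLinearMap ∘ₗ H.mulVecLin.rangeRestrict
  let p : (Fin H.rank → F) →ₗ[F] (Fin m → F) := W.subtype ∘ₗ e.symm.toLinearMap
  have hq : LinearMap.range q = ⊤ := by
    rw [LinearMap.range_eq_top]
    exact e.surjective.comp H.mulVecLin.surjective_rangeRestrict
  obtain ⟨r, hr⟩ := LinearMap.exists_rightInverse_of_surjective q hq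
  have hp : LinearMap.ker p = ⊥ := by
    rw [LinearMap.ker_eq_bot]
    exact W.injective_subtype.comp e.symm.injective
  obtain ⟨t, ht⟩ := LinearMap.exists_leftInverse_of_injective p hp
  refine ⟨LinearMap.toMatrix' p, LinearMap.toMatrix' q, LinearMap.toMatrix' r,
    LinearMap.toMatrix' t, ?_, ?_, ?_⟩
  · rw [← LinearMap.toMatrix'_comp]
    have : p ∘ₗ q = H.mulVecLin := by
      ext i
      simp [p, q]
    rw [this, ← Matrix.toLin'_apply', LinearMap.toMatrix'_toLin']
  · rw [← LinearMap.toMatrix'_comp, hr, LinearMap.toMatrix'_id]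
  · rw [← LinearMap.toMatrix'_comp, ht, LinearMap.toMatrix'_id]

open Matrix in
/-- If `x` and a vector `v` in the kernel of a matrix `H` over a field `F` of transcendence degree
`s` are such that `v` together with `c` elements of `F` is algebraically independent, then the
kernel of `H` is large. -/
theorem rank_add_card_le {k F L : Type} [Field k] [Field F] [Field L] [Algebra k F]
    [Algebra F L] [Algebra k L] [IsScalarTower k F L] {ι : Type} [Fintype ι] {m n s : ℕ}
    (H : Matrix (Fin m) (Fin n) F) (v : Fin n → L) (hv : (H.map (algebraMap F L)) *ᵥ v = 0)
    (x : ι → F) (hs : Algebra.trdeg k F = s)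
    (hind : AlgebraicIndependent k (Sum.elim v (algebraMap F L ∘ x))) :
    H.rank + Fintype.card ι ≤ s := by
  obtain ⟨P, Q, R, S, hH, hQR, hSP⟩ := exists_rank_factorization H
  obtain ⟨U, W, -, -, hM, -⟩ := exists_rank_factorization (1 - R * Q)
  have hQM : Q * (1 - R * Q) = 0 := by
    rw [Matrix.mul_sub, ← Matrix.mul_assoc, hQR, Matrix.mul_one, Matrix.one_mul, sub_self]
  have hQrank : H.rank ≤ Q.rank := by
    conv_lhs => rw [hH]
    exact Matrix.rank_mul_le_right P Q
  have hrank := Matrix.rank_add_rank_le_card_of_mul_eq_zero hQM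
  rw [Fintype.card_fin] at hrank
  set φ := algebraMap F L
  have hQv : Q.map φ *ᵥ v = 0 := by
    have h1 := congrArg (fun u => S.map φ *ᵥ u) hv
    have h2 : S * H = Q := 
      (congrArg (S * ·) hH).trans (by rw [← Matrix.mul_assoc, hSP, Matrix.one_mul])
    simpa [Matrix.mulVec_mulVec, ← Matrix.map_mul, h2] using h1
  have hvU : v = U.map φ *ᵥ (W.map φ *ᵥ v) := by
    rw [Matrix.mulVec_mulVec, ← Matrix.map_mul, ← hM, Matrix.map_sub _ (map_sub φ),
      Matrix.map_one _ (map_zero φ) (map_one φ), Matrix.sub_mulVec, Matrix.one_mulVec,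
      Matrix.map_mul, ← Matrix.mulVec_mulVec, hQv, Matrix.mulVec_zero, sub_zero]
  have key := card_le_trdeg_add_of_mem_adjoin hind hs (W.map φ *ᵥ v) (by
    rintro (i | i)
    · rw [Sum.elim_inl, congrFun hvU i, Matrix.mulVec, dotProduct]
      refine sum_mem fun j _ => mul_mem ?_ ?_
      · exact Subalgebra.algebraMap_mem _ _
      · exact Algebra.subset_adjoin ⟨j, rfl⟩
    · exact Subalgebra.algebraMap_mem _ _)
  rw [Fintype.card_sum, Fintype.card_fin] at key
  omega

open IntermediateField in
/-- A finite generating family of a field extension of a perfect field contains a separating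
transcendence basis. -/
theorem exists_isTranscendenceBasis_subfamily_isSeparable {k F : Type*} [Field k] [PerfectField k]
    [Field F] [Algebra k F] {ι : Type*} [Finite ι] (x : ι → F)
    (hx : adjoin k (Set.range x) = ⊤) :
    ∃ t : Set ι, IsTranscendenceBasis k (fun i : t => x i) ∧
      Algebra.IsSeparable (adjoin k (Set.range fun i : t => x i)) F := by
  have hex : {t : Set ι | IsTranscendenceBasis k (fun i : t => x i)}.Nonempty := by
    have : Algebra.IsAlgebraic (Algebra.adjoin k (Set.range x)) F := by
      rw [← isAlgebraic_adjoin_iff_top, hx, Algebra.isAlgebraic_iff_isIntegral]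
      exact Algebra.isIntegral_of_surjective topEquiv.surjective
    obtain ⟨t', ht', hbasis⟩ := exists_isTranscendenceBasis_subset (R := k) (Set.range x)
    obtain ⟨t, -, ht⟩ := Set.SurjOn.exists_bijOn_subset (f := x) (s := Set.univ) (t := t')
      (fun y hy => by simpa using ht' hy)
    exact ⟨t, hbasis.comp_equiv (ht.equiv x)⟩
  obtain ⟨t, ht, hmax⟩ := (Set.toFinite {t : Set ι | IsTranscendenceBasis k (fun i : t => x i)}
    ).exists_maximalFor (fun t => (separableClosure (adjoin k (x '' t)) F).restrictScalars k) _ hex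
  refine ⟨t, ht, ?_⟩
  rw [← Set.image_eq_range x t]
  obtain _ | ⟨p, hp, hpk⟩ := CharP.exists' k
  · have : Algebra.IsAlgebraic (adjoin k (x '' t)) F := by
      have := ht.isAlgebraic_field
      convert! this <;> exact Set.image_eq_range x t
    infer_instance
  have : ExpChar k p := .prime hp.out
  have : CharP F p := .of_ringHom_of_ne_zero (algebraMap k F) p hp.out.ne_zero
  have H : ∀ s : Finset F,
      LinearIndepOn k _root_.id (s : Set F) → LinearIndepOn k (· ^ p) (s : Set F) := by
    intro s hs
    refine hs.map_of_injective_injective (frobeniusEquiv k p).symm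
      (frobenius F p).toAddMonoidHom ?_ ?_ ?_
    · simp
    · simp
    · intro r y
      change ((frobeniusEquiv k p).symm r • y) ^ p = r • y ^ p
      rw [Algebra.smul_def, mul_pow, ← map_pow, Algebra.smul_def,
        show (frobeniusEquiv k p).symm r ^ p = r from (frobeniusEquiv k p).apply_symm_apply r]
  rw [← separableClosure.eq_top_iff, ← (restrictScalars_injective k).eq_iff,
    restrictScalars_top, eq_top_iff, ← hx, adjoin_le_iff]
  rintro _ ⟨m, rfl⟩
  by_contra hm
  have hmt : m ∉ t := fun h => hm (le_restrictScalars_separableClosure _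
    (subset_adjoin _ _ ⟨m, h, rfl⟩))
  obtain ⟨i, hi₁, hi₂⟩ := exists_isTranscendenceBasis_and_isSeparable_of_linearIndepOn_pow'
    p hp.out H t m ht hmt
  refine hm (hmax hi₁ ?_ ?_)
  · rw [separableClosure_le_separableClosure_iff, adjoin_le_iff]
    rintro _ ⟨j, hj, rfl⟩
    obtain rfl | ne := eq_or_ne j i
    exacts [hi₂, le_restrictScalars_separableClosure _ (subset_adjoin _ _ ⟨j, ⟨.inr hj, ne⟩, rfl⟩)]
  · obtain rfl | ne := eq_or_ne m i
    exacts [hi₂, le_restrictScalars_separableClosure _ (subset_adjoin _ _ ⟨m, ⟨.inl rfl, ne⟩, rfl⟩)]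

open scoped IntermediateField.algebraAdjoinAdjoin in
/-- Sections of nilpotent thickenings of a separably generated field can be prescribed on a
separating transcendence basis. -/
theorem exists_algHom_section {k F B : Type*} [Field k] [Field F] [Algebra k F] [CommRing B]
    [Algebra k B] {ι : Type*} {v : ι → F} (hv : AlgebraicIndependent k v)
    [Algebra.IsSeparable (IntermediateField.adjoin k (Set.range v)) F] (q : B →ₐ[k] F)
    (hq : Function.Surjective q) (hnil : IsNilpotent (RingHom.ker q)) (b : ι → B)
    (hb : ∀ i, q (b i) = v i) :
    ∃ σ : F →ₐ[k] B, (∀ a, q (σ a) = a) ∧ ∀ i, σ (v i) = b i := by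
  let S := Algebra.adjoin k (Set.range v)
  have : Algebra.FormallySmooth S (IntermediateField.adjoin k (Set.range v)) :=
    .of_isLocalization (nonZeroDivisors _)
  have : Algebra.FormallyEtale (IntermediateField.adjoin k (Set.range v)) F :=
    Algebra.FormallyEtale.of_isSeparable _ F
  have : Algebra.FormallySmooth S F := .comp _ (IntermediateField.adjoin k (Set.range v)) _
  let h : S →ₐ[k] B := (aeval b).comp hv.aevalEquiv.symm.toAlgHom
  have hqh : q.comp h = S.val := by
    have h1 : (q.comp h).comp hv.aevalEquiv.toAlgHom = S.val.comp hv.aevalEquiv.toAlgHom := by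
      ext i
      simp [h, hb, S]
    ext a
    obtain ⟨a, rfl⟩ := hv.aevalEquiv.surjective a
    exact DFunLike.congr_fun h1 a
  let _ : Algebra S B := h.toRingHom.toAlgebra
  have : IsScalarTower k S B := IsScalarTower.of_algebraMap_eq' h.comp_algebraMap.symm
  let q' : B →ₐ[S] F := { q with commutes' := fun a => DFunLike.congr_fun hqh a }
  let σ := Algebra.FormallySmooth.liftOfSurjective (AlgHom.id S F) q' hq hnil
  refine ⟨σ.restrictScalars k, fun a => ?_, fun i => ?_⟩
  · exact Algebra.FormallySmooth.liftOfSurjective_apply (AlgHom.id S F) q' hq hnil a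
  · let s : S := ⟨v i, Algebra.subset_adjoin ⟨i, rfl⟩⟩
    have h2 : hv.aevalEquiv (X i) = s := Subtype.ext (by simp [s])
    have h3 : σ (algebraMap S F s) = h s := σ.commutes s
    refine h3.trans ?_
    rw [← h2]
    simp [h]

theorem polySchmidtRank_le {k : Type} [Field k] {σ ι : Type} [Fintype ι] {f : MvPolynomial σ k}
    (g h : ι → MvPolynomial σ k) (hg : ∀ i, ∃ a, 0 < a ∧ (g i).IsHomogeneous a)
    (hh : ∀ i, ∃ b, 0 < b ∧ (h i).IsHomogeneous b) (hf : f = ∑ i, g i * h i) :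
    polySchmidtRank f ≤ Fintype.card ι := by
  let e := (Fintype.equivFin ι).symm
  refine Nat.sInf_le ⟨g ∘ e, h ∘ e, fun i => hg _, fun i => hh _, ?_⟩
  rw [hf]
  exact (e.sum_comp fun i => g i * h i).symm

/-- The Schmidt rank does not drop under extension of an algebraically closed base field. -/
theorem polySchmidtRank_le_of_map {k : Type} [Field k] [IsAlgClosed k] {F : Type*} [Field F]
    [Algebra k F] {σ ι : Type} [Fintype ι] {f : MvPolynomial σ k}
    (g h : ι → MvPolynomial σ F) (hg : ∀ i, ∃ a, 0 < a ∧ (g i).IsHomogeneous a)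
    (hh : ∀ i, ∃ b, 0 < b ∧ (h i).IsHomogeneous b)
    (hf : map (algebraMap k F) f = ∑ i, g i * h i) :
    polySchmidtRank f ≤ Fintype.card ι := by
  classical
  let S : Finset F := Finset.univ.biUnion fun i =>
    (g i).support.image (fun m => coeff m (g i)) ∪ (h i).support.image (fun m => coeff m (h i))
  let A := Algebra.adjoin k (S : Set F)
  have hA : Algebra.FiniteType k A := ⟨(Subalgebra.fg_top _).2 ⟨S, rfl⟩⟩
  have lift : ∀ p : MvPolynomial σ F, (∀ m ∈ p.support, coeff m p ∈ S) →
      ∃ q : MvPolynomial σ A, map (algebraMap A F) q = p := by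
    intro p hp
    change p ∈ Set.range (map (algebraMap A F))
    rw [MvPolynomial.mem_range_map_iff_coeffs_subset]
    intro a ha
    obtain ⟨m, hm, rfl⟩ := mem_coeffs_iff.1 ha
    exact ⟨⟨_, Algebra.subset_adjoin (hp m hm)⟩, rfl⟩
  have hS : ∀ i, (∀ m ∈ (g i).support, coeff m (g i) ∈ S) ∧
      ∀ m ∈ (h i).support, coeff m (h i) ∈ S := by
    refine fun i => ⟨fun m hm => ?_, fun m hm => ?_⟩
    · exact Finset.mem_biUnion.2 ⟨i, Finset.mem_univ i,
        Finset.mem_union_left _ (Finset.mem_image_of_mem _ hm)⟩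
    · exact Finset.mem_biUnion.2 ⟨i, Finset.mem_univ i,
        Finset.mem_union_right _ (Finset.mem_image_of_mem _ hm)⟩
  choose g' hg' using fun i => lift (g i) (hS i).1
  choose h' hh' using fun i => lift (h i) (hS i).2
  have hinj : Function.Injective (algebraMap A F) := Subtype.val_injective
  obtain ⟨m, hm⟩ := Ideal.exists_maximal A
  let K := A ⧸ m
  let _ : Field K := Ideal.Quotient.field m
  have hfin : Module.Finite k K := finite_of_finite_type_of_isJacobsonRing k K
  have hbij : Function.Bijective (algebraMap k K) :=
    IsAlgClosed.algebraMap_bijective_of_isIntegral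
  let e := RingEquiv.ofBijective _ hbij
  let φ : A →+* k := (e.symm : K →+* k).comp (Ideal.Quotient.mk m)
  have hφ : φ.comp (algebraMap k A) = RingHom.id k := by
    ext a
    exact e.symm_apply_apply a
  have hf' : map (algebraMap k A) f = ∑ i, g' i * h' i := by
    refine map_injective _ hinj ?_
    rw [map_map, ← IsScalarTower.algebraMap_eq, hf]
    simp [hg', hh']
  refine polySchmidtRank_le (fun i => map φ (g' i)) (fun i => map φ (h' i)) ?_ ?_ ?_
  · intro i
    obtain ⟨a, ha, hga⟩ := hg i
    rw [← hg'] at hga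
    exact ⟨a, ha, (IsHomogeneous.of_map hinj hga).map φ⟩
  · intro i
    obtain ⟨a, ha, hga⟩ := hh i
    rw [← hh'] at hga
    exact ⟨a, ha, (IsHomogeneous.of_map hinj hga).map φ⟩
  · have := congrArg (map φ) hf'
    rw [map_map, hφ, map_id] at this
    simpa using this

theorem homogeneousComponent_mul_of_isHomogeneous {F : Type*} [CommRing F] {σ : Type*}
    {n b : ℕ} (p : MvPolynomial σ F) {q : MvPolynomial σ F} (hq : q.IsHomogeneous b) (hb : b ≤ n) :
    homogeneousComponent n (p * q) = homogeneousComponent (n - b) p * q := by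
  let _ : GradedAlgebra (homogeneousSubmodule σ F) := MvPolynomial.gradedAlgebra
  rw [← decomposition.decompose'_apply, ← decomposition.decompose'_apply]
  exact DirectSum.coe_decompose_mul_of_right_mem_of_le (homogeneousSubmodule σ F) (a := p)
    ((mem_homogeneousSubmodule _ _).2 hq) hb

/-- A homogeneous element of an ideal spanned by homogeneous elements of smaller degree is a
combination of them with homogeneous coefficients. -/
theorem exists_homogeneous_coeff_of_mem_span {F : Type*} [CommRing F] {σ ι : Type*} [Fintype ι]
    {d : ℕ} {f : MvPolynomial σ F} (hf : f.IsHomogeneous d) (G : ι → MvPolynomial σ F) (a : ι → ℕ)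
    (hG : ∀ i, (G i).IsHomogeneous (a i)) (had : ∀ i, a i < d)
    (hmem : f ∈ Ideal.span (Set.range G)) :
    ∃ h : ι → MvPolynomial σ F, (∀ i, (h i).IsHomogeneous (d - a i)) ∧ f = ∑ i, G i * h i := by
  obtain ⟨c, hc⟩ := Ideal.mem_span_range_iff_exists_fun.1 hmem
  refine ⟨fun i => homogeneousComponent (d - a i) (c i),
    fun i => homogeneousComponent_isHomogeneous _ _, ?_⟩
  calc f = homogeneousComponent d f := by
        rw [homogeneousComponent_of_mem ((mem_homogeneousSubmodule _ _).2 hf), if_pos rfl]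
    _ = _ := by
        rw [← hc, map_sum]
        refine Finset.sum_congr rfl fun i _ => ?_
        rw [homogeneousComponent_mul_of_isHomogeneous _ (hG i) (had i).le, mul_comm]

theorem mem_sup_pow_idealOfVars {F σ : Type*} [CommRing F] {I : Ideal (MvPolynomial σ F)} {N : ℕ}
    {p : MvPolynomial σ F} (h : ∀ i < N, homogeneousComponent i p ∈ I) :
    p ∈ I ⊔ idealOfVars σ F ^ N := by
  rw [← sum_homogeneousComponent p]
  refine Ideal.sum_mem _ fun i _ ↦ ?_
  rcases lt_or_ge i N with hi | hi
  · exact Ideal.mem_sup_left (h i hi)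
  · refine Ideal.mem_sup_right ((mem_pow_idealOfVars_iff' _ _).2 fun m hm ↦ ?_)
    rw [coeff_homogeneousComponent, if_neg (by omega)]

theorem homogeneousComponent_mem_of_mem_sup_pow_idealOfVars {F σ : Type*} [CommRing F]
    {S : Set (MvPolynomial σ F)} (hS : ∀ p ∈ S, ∃ a, p.IsHomogeneous a) {N i : ℕ}
    {p : MvPolynomial σ F} (hp : p ∈ Ideal.span S ⊔ idealOfVars σ F ^ N) (hi : i < N) :
    homogeneousComponent i p ∈ Ideal.span S := by
  let _ : GradedAlgebra (homogeneousSubmodule σ F) := MvPolynomial.gradedAlgebra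
  obtain ⟨a, ha, b, hb, rfl⟩ := Submodule.mem_sup.1 hp
  have hb' : homogeneousComponent i b = 0 := by
    ext m
    rw [coeff_homogeneousComponent]
    split_ifs with hm
    · rw [(mem_pow_idealOfVars_iff' _ _).1 hb m (by omega), coeff_zero]
    · rw [coeff_zero]
  rw [map_add, hb', add_zero]
  refine homogeneousComponent_mem_of_mem (Ideal.homogeneous_span _ _ ?_) ha i
  intro p hp
  obtain ⟨a, ha⟩ := hS p hp
  exact ⟨a, (mem_homogeneousSubmodule _ _).2 ha⟩

theorem homogeneousComponent_add_mul_of_totalDegree_le {F σ : Type*} [CommRing F]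
    {a b : ℕ} {p q : MvPolynomial σ F} (hp : p.totalDegree ≤ a) (hq : q.totalDegree ≤ b) :
    homogeneousComponent (a + b) (p * q) = homogeneousComponent a p * homogeneousComponent b q := by
  classical
  ext m
  by_cases hm : m.degree = a + b
  · rw [coeff_homogeneousComponent, if_pos hm, coeff_mul, coeff_mul]
    refine Finset.sum_congr rfl fun x hx ↦ ?_
    rw [coeff_homogeneousComponent, coeff_homogeneousComponent]
    have hx' : x.1.degree + x.2.degree = a + b := by
      rw [← hm, ← Finset.HasAntidiagonal.mem_antidiagonal.1 hx, map_add]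
    by_cases h1 : x.1.degree = a
    · rw [if_pos h1, if_pos (by omega)]
    · rw [if_neg h1, zero_mul]
      rcases lt_or_gt_of_ne h1 with h1 | h1
      · rw [coeff_eq_zero_of_totalDegree_lt (f := q) (d := x.2), mul_zero]
        change _ < x.2.degree
        omega
      · rw [coeff_eq_zero_of_totalDegree_lt (f := p) (d := x.1), zero_mul]
        change _ < x.1.degree
        omega
  · rw [coeff_homogeneousComponent, if_neg hm]
    exact (((homogeneousComponent_isHomogeneous a p).mul
      (homogeneousComponent_isHomogeneous b q)).coeff_eq_zero hm).symm

/-- The leading form of a homogeneous polynomial composed with a translation is the polynomial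
itself. -/
theorem homogeneousComponent_aeval_C_add_X {k F σ : Type*} [CommRing k] [CommRing F] [Algebra k F]
    (x : σ → F) {e : ℕ} {p : MvPolynomial σ k} (hp : p.IsHomogeneous e) :
    homogeneousComponent e (aeval (fun j ↦ (C (x j) + X j : MvPolynomial σ F)) p) =
      map (algebraMap k F) p := by
  classical
  set w : σ → MvPolynomial σ F := fun j ↦ C (x j) + X j with hw
  have key : ∀ (m : σ →₀ ℕ) (a : k), (aeval w (monomial m a)).totalDegree ≤ m.degree ∧
      homogeneousComponent m.degree (aeval w (monomial m a)) =
        map (algebraMap k F) (monomial m a) := by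
    intro m
    induction m using Finsupp.induction_linear with
    | zero =>
      intro a
      have : aeval w (monomial 0 a) = C (algebraMap k F a) := by
        rw [← C_apply, aeval_C]; rfl
      rw [this, map_zero, map_monomial]
      exact ⟨by simp, by rw [homogeneousComponent_zero, coeff_C, if_pos rfl]; rfl⟩
    | add m₁ m₂ h₁ h₂ =>
      intro a
      have : (monomial (m₁ + m₂) a : MvPolynomial σ k) = monomial m₁ a * monomial m₂ 1 := by
        rw [monomial_mul, mul_one]
      rw [this, map_mul (aeval w), map_mul (map _), map_add,
        homogeneousComponent_add_mul_of_totalDegree_le (h₁ a).1 (h₂ 1).1, (h₁ a).2, (h₂ 1).2]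
      exact ⟨(totalDegree_mul _ _).trans (add_le_add (h₁ a).1 (h₂ 1).1), rfl⟩
    | single j l =>
      induction l with
      | zero =>
        intro a
        have : aeval w (monomial (Finsupp.single j 0) a) = C (algebraMap k F a) := by
          rw [Finsupp.single_zero, ← C_apply, aeval_C]; rfl
        rw [this, Finsupp.single_zero, map_zero, map_monomial]
        exact ⟨by simp, by rw [homogeneousComponent_zero, coeff_C, if_pos rfl]; rfl⟩
      | succ l ih =>
        intro a
        have : (monomial (Finsupp.single j (l + 1)) a : MvPolynomial σ k) =
            monomial (Finsupp.single j l) a * X j := by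
          rw [X, monomial_mul, mul_one, Finsupp.single_add]
        have h1 : (w j).totalDegree ≤ 1 := by
          refine (totalDegree_add _ _).trans (max_le (by simp) ?_)
          exact (isHomogeneous_X F j).totalDegree_le
        have h2 : homogeneousComponent 1 (w j) = X j := by
          rw [hw, map_add, homogeneousComponent_eq_zero _ (C (x j)) (by simp), zero_add,
            homogeneousComponent_of_mem ((mem_homogeneousSubmodule _ _).2 (isHomogeneous_X F j)),
            if_pos rfl]
        rw [this, map_mul (aeval w), map_mul (map _), Finsupp.single_add, map_add, aeval_X, map_X,
          Finsupp.degree_single j 1, homogeneousComponent_add_mul_of_totalDegree_le (ih a).1 h1,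
          (ih a).2, h2]
        exact ⟨(totalDegree_mul _ _).trans (add_le_add (ih a).1 h1), rfl⟩
  conv_lhs => rw [p.as_sum]
  conv_rhs => rw [p.as_sum]
  rw [map_sum, map_sum, map_sum]
  refine Finset.sum_congr rfl fun m hm ↦ ?_
  have : m.degree = e := by
    by_contra h
    exact mem_support_iff.1 hm (hp.coeff_eq_zero h)
  rw [← this, (key _ _).2]

theorem sum_X_mul_X_mul_pderiv_pderiv {F σ : Type*} [CommRing F] [Fintype σ] {d : ℕ}
    {p : MvPolynomial σ F} (hp : p.IsHomogeneous d) :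
    ∑ i, ∑ j, X i * X j * pderiv i (pderiv j p) = (d * (d - 1)) • p := by
  have h : ∀ j, ∑ i, X i * X j * pderiv i (pderiv j p) = (d - 1) • (X j * pderiv j p) := by
    intro j
    rw [← mul_smul_comm, ← (hp.pderiv (i := j)).sum_X_mul_pderiv, Finset.mul_sum]
    exact Finset.sum_congr rfl fun i _ ↦ by ring
  rw [Finset.sum_comm, Finset.sum_congr rfl fun j _ ↦ h j, ← Finset.smul_sum, hp.sum_X_mul_pderiv,
    ← mul_smul, mul_comm]

theorem sub_C_constantCoeff_mem_idealOfVars {F σ : Type*} [CommRing F] (p : MvPolynomial σ F) :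
    p - C (constantCoeff p) ∈ idealOfVars σ F := by
  rw [← pow_one (idealOfVars σ F), mem_pow_idealOfVars_iff']
  intro m hm
  have : m = 0 := by rw [← Finsupp.degree_eq_zero_iff]; omega
  subst this
  simp [constantCoeff_eq]

theorem map_mem_span_of_hessian_factorization {k F : Type*} [Field k] [Field F] [Algebra k F]
    {n d ρ : ℕ} (hd : 3 ≤ d) (hchar : ((d * (d - 1) : ℕ) : F) ≠ 0) {f : MvPolynomial (Fin n) k}
    (hf : f.IsHomogeneous d) (x : Fin n → F) (u : Fin n → MvPolynomial (Fin n) F)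
    (P : Fin n → Fin ρ → MvPolynomial (Fin n) F) (Q : Fin ρ → Fin n → MvPolynomial (Fin n) F)
    (hPQ : ∀ i j, aeval u (pderiv i (pderiv j f)) - ∑ a, P i a * Q a j ∈
      idealOfVars (Fin n) F ^ (d - 1))
    (T : Fin ρ → Fin ρ → F)
    (hT : ∀ i a, constantCoeff (P i a) = ∑ b, constantCoeff (Q b i) * T b a)
    {S : Set (MvPolynomial (Fin n) F)} (hS : ∀ p ∈ S, ∃ a, p.IsHomogeneous a)
    (hu : ∀ j, u j - (C (x j) + X j) ∈ Ideal.span S ⊔ idealOfVars (Fin n) F ^ (d - 1))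
    (hq : ∀ a, ∑ j, Q a j * X j ∈ Ideal.span S ⊔ idealOfVars (Fin n) F ^ (d - 1)) :
    map (algebraMap k F) f ∈ Ideal.span S := by
  set M := idealOfVars (Fin n) F with hM
  set I := Ideal.span S with hI
  have hX : ∀ i, (X i : MvPolynomial (Fin n) F) ∈ M := fun i ↦ Ideal.subset_span ⟨i, rfl⟩
  have hmul : ∀ {a b c : ℕ} {p q : MvPolynomial (Fin n) F}, c ≤ a + b → p ∈ I ⊔ M ^ a →
      q ∈ I ⊔ M ^ b → p * q ∈ I ⊔ M ^ c := by
    intro a b c p q habc hp hq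
    obtain ⟨p₁, hp₁, p₂, hp₂, rfl⟩ := Submodule.mem_sup.1 hp
    obtain ⟨q₁, hq₁, q₂, hq₂, rfl⟩ := Submodule.mem_sup.1 hq
    have h : (p₁ + p₂) * (q₁ + q₂) = (p₁ * (q₁ + q₂) + p₂ * q₁) + p₂ * q₂ := by ring
    rw [h]
    refine add_mem (Ideal.mem_sup_left (add_mem (I.mul_mem_right _ hp₁) (I.mul_mem_left _ hq₁)))
      (Ideal.mem_sup_right (Ideal.pow_le_pow_right habc ?_))
    rw [pow_add]
    exact Ideal.mul_mem_mul hp₂ hq₂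
  have hXX : ∀ i j, (X i * X j : MvPolynomial (Fin n) F) ∈ I ⊔ M ^ 2 := fun i j ↦
    Ideal.mem_sup_right (by rw [pow_two]; exact Ideal.mul_mem_mul (hX i) (hX j))
  have hle : I ⊔ M ^ (d - 1) ≤ I ⊔ M ^ 2 := sup_le_sup_left (Ideal.pow_le_pow_right (by omega)) _
  have hcc : ∀ (p : MvPolynomial (Fin n) F) i, X i * (p - C (constantCoeff p)) ∈ I ⊔ M ^ 2 := by
    intro p i
    refine Ideal.mem_sup_right ?_
    rw [pow_two]
    exact Ideal.mul_mem_mul (hX i) (sub_C_constantCoeff_mem_idealOfVars p)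
  have hq1 : ∀ b, ∑ j, C (constantCoeff (Q b j)) * X j ∈ I ⊔ M ^ 2 := by
    intro b
    have h : ∑ j, C (constantCoeff (Q b j)) * X j = ∑ j, Q b j * X j -
        ∑ j, X j * (Q b j - C (constantCoeff (Q b j))) := by
      rw [← Finset.sum_sub_distrib]
      exact Finset.sum_congr rfl fun j _ ↦ by ring
    rw [h]
    exact sub_mem (hle (hq b)) (sum_mem fun j _ ↦ hcc _ _)
  have hp : ∀ a, ∑ i, X i * P i a ∈ I ⊔ M ^ 2 := by
    intro a
    have h : ∑ i, X i * P i a = ∑ i, X i * (P i a - C (constantCoeff (P i a))) +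
        ∑ b, C (T b a) * ∑ j, C (constantCoeff (Q b j)) * X j := by
      simp_rw [Finset.mul_sum]
      rw [Finset.sum_comm, ← Finset.sum_add_distrib]
      refine Finset.sum_congr rfl fun i _ ↦ ?_
      rw [hT i a, map_sum, mul_sub, Finset.mul_sum]
      have : ∑ b, X i * C (constantCoeff (Q b i) * T b a) =
          ∑ b, C (T b a) * (C (constantCoeff (Q b i)) * X i) :=
        Finset.sum_congr rfl fun b _ ↦ by rw [C_mul]; ring
      rw [this, sub_add_cancel]
    rw [h]
    exact add_mem (sum_mem fun j _ ↦ hcc _ _) (sum_mem fun b _ ↦ Ideal.mul_mem_left _ _ (hq1 b))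
  set w : Fin n → MvPolynomial (Fin n) F := fun j ↦ C (x j) + X j with hw
  have huw : ∀ p : MvPolynomial (Fin n) k, aeval w p - aeval u p ∈ I ⊔ M ^ (d - 1) := by
    intro p
    rw [← Ideal.Quotient.eq]
    have h : ∀ y : Fin n → MvPolynomial (Fin n) F,
        Ideal.Quotient.mk (I ⊔ M ^ (d - 1)) (aeval y p) =
          aeval (fun j ↦ Ideal.Quotient.mk (I ⊔ M ^ (d - 1)) (y j)) p := fun y ↦
      (comp_aeval_apply (f := y) (Ideal.Quotient.mkₐ k (I ⊔ M ^ (d - 1))) p)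
    rw [h, h]
    congr 2
    funext j
    exact (Ideal.Quotient.eq.2 (hu j)).symm
  have hZ : ∑ i, ∑ j, X i * X j * aeval w (pderiv i (pderiv j f)) ∈ I ⊔ M ^ (d + 1) := by
    have h : ∑ i, ∑ j, X i * X j * aeval w (pderiv i (pderiv j f)) =
        ∑ i, ∑ j, (X i * X j * (aeval w (pderiv i (pderiv j f)) - aeval u (pderiv i (pderiv j f)))
          + X i * X j * (aeval u (pderiv i (pderiv j f)) - ∑ a, P i a * Q a j)) +
        ∑ a, (∑ i, X i * P i a) * ∑ j, Q a j * X j := by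
      have h' : ∑ a, (∑ i, X i * P i a) * ∑ j, Q a j * X j =
          ∑ i, ∑ j, X i * X j * ∑ a, P i a * Q a j := by
        simp_rw [Finset.sum_mul_sum, Finset.mul_sum]
        rw [Finset.sum_comm]
        refine Finset.sum_congr rfl fun i _ ↦ ?_
        rw [Finset.sum_comm]
        exact Finset.sum_congr rfl fun j _ ↦ Finset.sum_congr rfl fun a _ ↦ by ring
      rw [h', ← Finset.sum_add_distrib]
      refine Finset.sum_congr rfl fun i _ ↦ ?_
      rw [← Finset.sum_add_distrib]
      exact Finset.sum_congr rfl fun j _ ↦ by ring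
    rw [h]
    refine add_mem (sum_mem fun i _ ↦ sum_mem fun j _ ↦ add_mem ?_ ?_) (sum_mem fun a _ ↦ ?_)
    · exact hmul (by omega) (hXX i j) (huw _)
    · exact hmul (by omega) (hXX i j) (Ideal.mem_sup_right (hPQ i j))
    · exact hmul (by omega) (hp a) (hq a)
  have hcomp := homogeneousComponent_mem_of_mem_sup_pow_idealOfVars hS hZ (Nat.lt_succ_self d)
  have htop : homogeneousComponent d (∑ i, ∑ j, X i * X j * aeval w (pderiv i (pderiv j f))) =
      (d * (d - 1)) • map (algebraMap k F) f := by
    rw [← sum_X_mul_X_mul_pderiv_pderiv (hf.map _)]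
    simp_rw [map_sum]
    refine Finset.sum_congr rfl fun i _ ↦ Finset.sum_congr rfl fun j _ ↦ ?_
    rw [mul_comm, homogeneousComponent_mul_of_isHomogeneous _
      ((isHomogeneous_X F i).mul (isHomogeneous_X F j)) (by omega), mul_comm]
    have h2 : (pderiv i (pderiv j f)).IsHomogeneous (d - (1 + 1)) := by
      rw [← Nat.sub_sub]; exact hf.pderiv.pderiv
    rw [homogeneousComponent_aeval_C_add_X x h2, pderiv_map, pderiv_map]
  rw [htop] at hcomp
  have h : map (algebraMap k F) f = C ((d * (d - 1) : ℕ) : F)⁻¹ *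
      ((d * (d - 1)) • map (algebraMap k F) f) := by
    rw [nsmul_eq_mul, ← mul_assoc, ← map_natCast (C (σ := Fin n) (R := F)), ← C_mul,
      inv_mul_cancel₀ hchar, C_1, one_mul]
  rw [h]
  exact Ideal.mul_mem_left _ _ hcomp

theorem pderiv_comm {R σ : Type*} [CommRing R] (i j : σ) (p : MvPolynomial σ R) :
    pderiv i (pderiv j p) = pderiv j (pderiv i p) := by
  classical
  have h : ⁅pderiv (R := R) i, pderiv (R := R) j⁆ = 0 := by
    refine derivation_ext fun l ↦ ?_
    simp [Derivation.commutator_apply, pderiv_X, Pi.single_apply, apply_ite]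
  have h2 := congrArg (fun D : Derivation R (MvPolynomial σ R) (MvPolynomial σ R) ↦ D p) h
  simpa [Derivation.commutator_apply, sub_eq_zero] using h2

/-- At a point `x` with separating transcendence basis `(x i)_{i ∈ t}`, the codimension of `x` and
the rank of the Hessian at `x` bound the Schmidt rank. -/
theorem polySchmidtRank_le_of_isSeparable {k F : Type} [Field k] [IsAlgClosed k] [Field F]
    [Algebra k F] {n d : ℕ} (hd : 3 ≤ d) (hchar : ((d * (d - 1) : ℕ) : F) ≠ 0)
    {f : MvPolynomial (Fin n) k} (hf : f.IsHomogeneous d) (x : Fin n → F) (t : Set (Fin n))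
    (ht : AlgebraicIndependent k fun i : t ↦ x i)
    [Algebra.IsSeparable (IntermediateField.adjoin k (Set.range fun i : t ↦ x i)) F] :
    polySchmidtRank f ≤ (tᶜ.ncard +
      (Matrix.of fun i j ↦ aeval x (pderiv i (pderiv j f))).rank) * (d - 2) := by
  classical
  set H : Matrix (Fin n) (Fin n) F := Matrix.of fun i j ↦ aeval x (pderiv i (pderiv j f)) with hH
  obtain ⟨P, Q, R, -, hHPQ, hQR, -⟩ := exists_rank_factorization H
  set M := idealOfVars (Fin n) F with hM
  have hMker : ∀ p ∈ M, constantCoeff p = 0 := by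
    intro p hp
    rw [hM, ← pow_one (idealOfVars _ _), mem_pow_idealOfVars_iff'] at hp
    rw [constantCoeff_eq]
    exact hp 0 (by simp)
  have hkerM : ∀ p, constantCoeff p = 0 → p ∈ M := by
    intro p hp
    have := sub_C_constantCoeff_mem_idealOfVars p
    rwa [hp, C_0, sub_zero] at this
  set c : MvPolynomial (Fin n) F →ₐ[k] F :=
    (aeval (fun _ ↦ (0 : F)) : MvPolynomial (Fin n) F →ₐ[F] F).restrictScalars k with hc
  have hcc : ∀ p, c p = constantCoeff p := fun p ↦ by
    rw [hc, AlgHom.restrictScalars_apply, aeval_zero', Algebra.algebraMap_self_apply]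
  let q : (MvPolynomial (Fin n) F ⧸ M ^ (d - 1)) →ₐ[k] F := Ideal.Quotient.liftₐ (M ^ (d - 1)) c
    fun p hp ↦ by rw [hcc, hMker p (Ideal.pow_le_self (by omega) hp)]
  have hqmk : ∀ p, q (Ideal.Quotient.mk _ p) = constantCoeff p := fun p ↦ hcc p
  have hqs : Function.Surjective q := fun a ↦ ⟨Ideal.Quotient.mk _ (C a), by simp [hqmk]⟩
  have hnil : IsNilpotent (RingHom.ker q) := by
    refine ⟨d - 1, ?_⟩
    have h : RingHom.ker q ≤ M.map (Ideal.Quotient.mk (M ^ (d - 1))) := by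
      intro b hb
      obtain ⟨p, rfl⟩ := Ideal.Quotient.mk_surjective b
      exact Ideal.mem_map_of_mem _ (hkerM p (by rw [← hqmk]; exact hb))
    have h2 := Ideal.pow_right_mono h (d - 1)
    rw [← Ideal.map_pow, Ideal.map_quotient_self] at h2
    exact le_bot_iff.1 h2
  obtain ⟨s, hs, hst⟩ := exists_algHom_section ht q hqs hnil
    (fun i ↦ Ideal.Quotient.mk _ (C (x i) + X (i : Fin n))) (fun i ↦ by simp [hqmk])
  have hlift : ∀ a : F, ∃ p : MvPolynomial (Fin n) F, Ideal.Quotient.mk (M ^ (d - 1)) p = s a :=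
    fun a ↦ Ideal.Quotient.mk_surjective _
  choose l hl using hlift
  have hlc : ∀ a, constantCoeff (l a) = a := fun a ↦ by rw [← hqmk, hl, hs]
  let u : Fin n → MvPolynomial (Fin n) F := fun j ↦ if j ∈ t then C (x j) + X j else l (x j)
  have hu : ∀ j, Ideal.Quotient.mk (M ^ (d - 1)) (u j) = s (x j) := by
    intro j
    by_cases hj : j ∈ t
    · simp only [u, if_pos hj]
      exact (hst ⟨j, hj⟩).symm
    · simp only [u, if_neg hj, hl]
  let η : Fin n → MvPolynomial (Fin n) F := fun j ↦ u j - (C (x j) + X j)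
  let y : Fin H.rank → MvPolynomial (Fin n) F := fun a ↦ ∑ j, l (Q a j) * X j
  let g : ↥tᶜ ⊕ Fin H.rank → MvPolynomial (Fin n) F := Sum.elim (fun j ↦ η j) y
  have hη0 : ∀ j, constantCoeff (η j) = 0 := by
    intro j
    have h : constantCoeff (u j) = x j := by rw [← hqmk, hu, hs]
    simp [η, h]
  have hg0 : ∀ i, constantCoeff (g i) = 0 := by
    rintro (j | a)
    · exact hη0 j
    · simp [g, y]
  let G : (↥tᶜ ⊕ Fin H.rank) × Fin (d - 2) → MvPolynomial (Fin n) F := fun i ↦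
    homogeneousComponent (i.2 + 1) (g i.1)
  have hG : ∀ i, (G i).IsHomogeneous (i.2 + 1) := fun i ↦ homogeneousComponent_isHomogeneous _ _
  have hgmem : ∀ i, g i ∈ Ideal.span (Set.range G) ⊔ M ^ (d - 1) := by
    intro i
    refine mem_sup_pow_idealOfVars fun m hm ↦ ?_
    rcases Nat.eq_zero_or_pos m with rfl | hm0
    · rw [homogeneousComponent_zero, ← constantCoeff_eq, hg0, C_0]
      exact zero_mem _
    · refine Ideal.subset_span ⟨(i, ⟨m - 1, by omega⟩), ?_⟩
      simp only [G, Nat.sub_add_cancel hm0]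
  have hmem : map (algebraMap k F) f ∈ Ideal.span (Set.range G) := by
    refine map_mem_span_of_hessian_factorization hd hchar hf x u (fun i a ↦ l (P i a))
      (fun a j ↦ l (Q a j)) ?_ (P.transpose * R) ?_ ?_ ?_ fun a ↦ hgmem (Sum.inr a)
    · intro i j
      rw [← Ideal.Quotient.eq, map_sum]
      have h := comp_aeval_apply (f := u) (Ideal.Quotient.mkₐ k (M ^ (d - 1)))
        (pderiv i (pderiv j f))
      have h2 : (fun j ↦ Ideal.Quotient.mkₐ k (M ^ (d - 1)) (u j)) = fun j ↦ s (x j) :=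
        funext hu
      rw [h2, ← comp_aeval_apply] at h
      refine h.trans ?_
      have h3 : aeval x (pderiv i (pderiv j f)) = ∑ a, P i a * Q a j := by
        rw [← Matrix.mul_apply, ← hHPQ, hH, Matrix.of_apply]
      rw [h3, map_sum]
      exact Finset.sum_congr rfl fun a _ ↦ by rw [map_mul, map_mul, hl, hl]
    · intro i a
      simp_rw [hlc]
      have hsymm : H.transpose = H := by
        ext i j
        simp only [hH, Matrix.transpose_apply, Matrix.of_apply]
        rw [pderiv_comm]
      have h : P = Q.transpose * (P.transpose * R) := by
        rw [← Matrix.mul_assoc, ← Matrix.transpose_mul, ← hHPQ, hsymm]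
        exact (Matrix.mul_one P).symm.trans (by rw [← hQR, ← Matrix.mul_assoc, ← hHPQ])
      conv_lhs => rw [h]
      rw [Matrix.mul_apply]
      rfl
    · rintro _ ⟨i, rfl⟩
      exact ⟨_, hG i⟩
    · intro j
      by_cases hj : j ∈ t
      · simp only [u, if_pos hj, sub_self]
        exact zero_mem _
      · exact hgmem (Sum.inl ⟨j, hj⟩)
  obtain ⟨h, hh, hfe⟩ := exists_homogeneous_coeff_of_mem_span (hf.map (algebraMap k F)) G
    (fun i ↦ i.2 + 1) hG (fun i ↦ by have := i.2.2; omega) hmem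
  refine (polySchmidtRank_le_of_map G h (fun i ↦ ⟨_, Nat.succ_pos _, hG i⟩)
    (fun i ↦ ⟨_, ?_, hh i⟩) hfe).trans (le_of_eq ?_)
  · have := i.2.2
    omega
  · rw [Fintype.card_prod, Fintype.card_sum, Fintype.card_fin, Fintype.card_fin,
      ← Nat.card_eq_fintype_card, Nat.card_coe_set_eq]

/-- If the derivative of `f` in a generic direction is a sum of `r` products of polynomials without
constant term, then the Schmidt rank of `f` is at most `2 * r * (d - 2)`. -/
theorem polySchmidtRank_le_of_algebraicIndependent {k E : Type} [Field k] [IsAlgClosed k] [Field E]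
    [Algebra k E] {n d r : ℕ} (hd : 3 ≤ d) (hchar : ((d * (d - 1) : ℕ) : k) ≠ 0)
    {f : MvPolynomial (Fin n) k} (hf : f.IsHomogeneous d) {v : Fin n → E}
    (hv : AlgebraicIndependent k v) (g h : Fin r → MvPolynomial (Fin n) E)
    (hg : ∀ i, constantCoeff (g i) = 0) (hh : ∀ i, constantCoeff (h i) = 0)
    (hsum : ∑ j, C (v j) * pderiv j (map (algebraMap k E) f) = ∑ i, g i * h i) :
    polySchmidtRank f ≤ 2 * r * (d - 2) := by
  classical
  obtain ⟨L, _, _, x, hx, t, ht, htn⟩ := exists_zero_of_constantCoeff_eq_zero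
    (Sum.elim g h ∘ finSumFinEquiv.symm) (fun i ↦ by
      rcases hi : finSumFinEquiv.symm i with j | j
      · simp [hi, hg]
      · simp [hi, hh])
  have hxg : ∀ i, aeval x (g i) = 0 := fun i ↦ by
    simpa only [Function.comp_apply, Equiv.symm_apply_apply, Sum.elim_inl] using
      hx (finSumFinEquiv (Sum.inl i))
  have hxh : ∀ i, aeval x (h i) = 0 := fun i ↦ by
    simpa only [Function.comp_apply, Equiv.symm_apply_apply, Sum.elim_inr] using
      hx (finSumFinEquiv (Sum.inr i))
  let _ : Algebra k L := ((algebraMap E L).comp (algebraMap k E)).toAlgebra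
  have : IsScalarTower k E L := IsScalarTower.of_algebraMap_eq fun _ ↦ rfl
  let F := IntermediateField.adjoin k (Set.range x)
  let y : Fin n → F := fun i ↦ ⟨x i, IntermediateField.subset_adjoin k _ ⟨i, rfl⟩⟩
  have hy : IntermediateField.adjoin k (Set.range y) = ⊤ := by
    apply IntermediateField.map_injective F.val
    rw [IntermediateField.adjoin_map, ← Set.range_comp, ← AlgHom.fieldRange_eq_map,
      IntermediateField.fieldRange_val]
    rfl
  obtain ⟨t', ht', _⟩ := exists_isTranscendenceBasis_subfamily_isSeparable y hy
  have hchar' : ((d * (d - 1) : ℕ) : F) ≠ 0 := by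
    rw [← map_natCast (algebraMap k F)]
    exact (map_ne_zero _).2 hchar
  have hle := polySchmidtRank_le_of_isSeparable hd hchar' hf y t' ht'.1
  have hs : Algebra.trdeg k F = t'.ncard := by
    rw [← ht'.cardinalMk_eq_trdeg, ← Nat.card_coe_set_eq, Nat.cast_card]
  have hker : ((Matrix.of fun i j ↦ aeval y (pderiv i (pderiv j f))).map (algebraMap F L)).mulVec
      (algebraMap E L ∘ v) = 0 := by
    funext i
    have h1 := congrArg (fun p ↦ aeval x (pderiv i p)) hsum
    simp only [map_sum, Derivation.leibniz, map_add, smul_eq_mul, map_mul, hxg, hxh, zero_mul,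
      add_zero, Finset.sum_const_zero, pderiv_C, mul_zero, aeval_C, pderiv_map,
      aeval_map_algebraMap] at h1
    rw [Pi.zero_apply, ← h1, Matrix.mulVec, dotProduct]
    refine Finset.sum_congr rfl fun j _ ↦ ?_
    rw [Matrix.map_apply, Matrix.of_apply, mul_comm, ← aeval_algebraMap_apply]
    rfl
  have hind : AlgebraicIndependent k (Sum.elim (algebraMap E L ∘ v)
      (algebraMap F L ∘ fun i : t ↦ y i)) := by
    have h1 : AlgebraicIndependent k (Sum.elim (fun i : t ↦ x i) (algebraMap E L ∘ v)) :=
      hv.sumElim_comp ht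
    convert h1.comp (Equiv.sumComm (Fin n) t) (Equiv.injective _) using 1
    funext i
    rcases i with i | i <;> rfl
  have hrank := rank_add_card_le _ _ hker _ hs hind
  rw [← Nat.card_eq_fintype_card, Nat.card_coe_set_eq] at hrank
  have hcompl := Set.ncard_add_ncard_compl t'
  rw [Nat.card_fin] at hcompl
  exact hle.trans (Nat.mul_le_mul_right _ (by omega))

theorem exists_map_evalRingHom_eq {k σ D : Type*} [CommRing k] [Finite σ] {N : ℕ}
    (q : D → MvPolynomial σ k) (hq : ∀ v, (q v).totalDegree ≤ N) :
    ∃ Q : MvPolynomial σ (D → k), ∀ v, map (Pi.evalRingHom (fun _ ↦ k) v) Q = q v := by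
  classical
  have hfin : {m : σ →₀ ℕ | m.degree ≤ N}.Finite := Finsupp.finite_of_degree_le N
  refine ⟨∑ m ∈ hfin.toFinset, monomial m fun v ↦ coeff m (q v), fun v ↦ ?_⟩
  rw [map_sum]
  ext m
  simp only [map_monomial, coeff_sum, coeff_monomial, Pi.evalRingHom_apply]
  rw [Finset.sum_ite_eq']
  split_ifs with h
  · rfl
  · refine (coeff_eq_zero_of_totalDegree_lt ((hq v).trans_lt ?_)).symm
    rw [Set.Finite.mem_toFinset, Set.mem_ofPred_eq, not_le] at h
    exact h

/-- A decomposition of `∑ j, v j • p j` available for a Zariski dense set of points `v`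
yields such a decomposition at a generic point over some field extension. -/
theorem exists_generic_decomposition {k : Type} [Field k] {n r N : ℕ}
    (p : Fin n → MvPolynomial (Fin n) k) (D : Set (Fin n → k))
    (hD : ∀ q : MvPolynomial (Fin n) k, q ≠ 0 → ∃ v ∈ D, eval v q ≠ 0)
    (hdec : ∀ v ∈ D, ∃ g h : Fin r → MvPolynomial (Fin n) k,
      (∀ i, constantCoeff (g i) = 0 ∧ (g i).totalDegree ≤ N) ∧
      (∀ i, constantCoeff (h i) = 0 ∧ (h i).totalDegree ≤ N) ∧
      ∑ j, v j • p j = ∑ i, g i * h i) :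
    ∃ (E : Type) (_ : Field E) (_ : Algebra k E) (v : Fin n → E)
      (g h : Fin r → MvPolynomial (Fin n) E), AlgebraicIndependent k v ∧
      (∀ i, constantCoeff (g i) = 0) ∧ (∀ i, constantCoeff (h i) = 0) ∧
      ∑ j, C (v j) * map (algebraMap k E) (p j) = ∑ i, g i * h i := by
  choose! g h hg hh hgh using hdec
  let ev : MvPolynomial (Fin n) k →ₐ[k] (D → k) := aeval fun j v ↦ (v : Fin n → k) j
  have hev : ∀ q v, ev q v = eval (v : Fin n → k) q := by
    intro q v
    have := comp_aeval_apply (f := fun j (v : D) ↦ (v : Fin n → k) j)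
      (Pi.evalAlgHom k (fun _ : D ↦ k) v) q
    rw [← coe_aeval_eq_eval]
    exact this
  let S : Submonoid (D → k) := (nonZeroDivisors (MvPolynomial (Fin n) k)).map ev
  have hS : Disjoint ((⊥ : Ideal (D → k)) : Set (D → k)) S := by
    rw [Set.disjoint_left]
    rintro _ h0 ⟨q, hq, rfl⟩
    obtain ⟨v, hv, hvq⟩ := hD q (nonZeroDivisors.ne_zero hq)
    apply hvq
    rw [← hev q ⟨v, hv⟩]
    exact congrFun (show ev q = 0 from h0) ⟨v, hv⟩
  obtain ⟨P, hP, -, hPS⟩ := Ideal.exists_le_prime_disjoint _ S hS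
  let φ : (D → k) →ₐ[k] FractionRing ((D → k) ⧸ P) :=
    (IsScalarTower.toAlgHom k ((D → k) ⧸ P) _).comp (Ideal.Quotient.mkₐ k P)
  have hφ : ∀ a, φ a = 0 → a ∈ P := by
    intro a ha
    exact Ideal.Quotient.eq_zero_iff_mem.1
      ((IsFractionRing.injective ((D → k) ⧸ P) (FractionRing ((D → k) ⧸ P)))
        (ha.trans (map_zero _).symm))
  choose G hG using fun i ↦ exists_map_evalRingHom_eq (N := N)
    (fun v : D ↦ g v i) (fun v ↦ (hg v v.2 i).2)
  choose H hH using fun i ↦ exists_map_evalRingHom_eq (N := N)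
    (fun v : D ↦ h v i) (fun v ↦ (hh v v.2 i).2)
  refine ⟨FractionRing ((D → k) ⧸ P), inferInstance, inferInstance,
    fun j ↦ φ fun v ↦ (v : Fin n → k) j, fun i ↦ map φ.toRingHom (G i),
    fun i ↦ map φ.toRingHom (H i), ?_, fun i ↦ ?_, fun i ↦ ?_, ?_⟩
  · rw [algebraicIndependent_iff]
    intro q hq
    by_contra hq0
    rw [← comp_aeval_apply] at hq
    exact Set.disjoint_left.1 hPS (hφ _ hq) ⟨q, mem_nonZeroDivisors_of_ne_zero hq0, rfl⟩
  · rw [constantCoeff_map]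
    have : constantCoeff (G i) = 0 := by
      funext v
      rw [Pi.zero_apply, ← (hg v v.2 i).1, ← hG i v, constantCoeff_map, Pi.evalRingHom_apply]
    rw [this, map_zero]
  · rw [constantCoeff_map]
    have : constantCoeff (H i) = 0 := by
      funext v
      rw [Pi.zero_apply, ← (hh v v.2 i).1, ← hH i v, constantCoeff_map, Pi.evalRingHom_apply]
    rw [this, map_zero]
  · have key : ∑ j, C (fun v : D ↦ (v : Fin n → k) j) * map (algebraMap k (D → k)) (p j) =
        ∑ i, G i * H i := by
      ext m v
      have h1 : ∀ q : MvPolynomial (Fin n) (D → k),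
          coeff m q v = coeff m (map (Pi.evalRingHom (fun _ ↦ k) v) q) := fun q ↦ by
        rw [coeff_map, Pi.evalRingHom_apply]
      rw [h1, h1]
      congr 1
      simp only [map_sum, map_mul, hG, hH, map_C, map_map, Pi.evalRingHom_apply]
      rw [← hgh v v.2]
      refine Finset.sum_congr rfl fun j _ ↦ ?_
      have h2 : (Pi.evalRingHom (fun _ ↦ k) v).comp (algebraMap k (D → k)) = RingHom.id k := rfl
      rw [h2, map_id, smul_eq_C_mul]
    have := congrArg (map φ.toRingHom) key
    simp only [map_sum, map_mul, map_C, map_map] at this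
    rw [← this]
    refine Finset.sum_congr rfl fun j _ ↦ ?_
    congr 2

theorem exists_decomposition_of_polySchmidtRank_le {k : Type} [Field k] {n e r : ℕ}
    {w : MvPolynomial (Fin n) k} (hw : w.IsHomogeneous e) (he : 2 ≤ e) (hchar : (e : k) ≠ 0)
    (hr : polySchmidtRank w ≤ r) :
    ∃ g h : Fin r → MvPolynomial (Fin n) k,
      (∀ i, constantCoeff (g i) = 0 ∧ (g i).totalDegree ≤ e) ∧
      (∀ i, constantCoeff (h i) = 0 ∧ (h i).totalDegree ≤ e) ∧ w = ∑ i, g i * h i := by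
  classical
  have hne : {r | ∃ g h : Fin r → MvPolynomial (Fin n) k,
      (∀ i, ∃ a, 0 < a ∧ (g i).IsHomogeneous a) ∧ (∀ i, ∃ b, 0 < b ∧ (h i).IsHomogeneous b) ∧
      w = ∑ i, g i * h i}.Nonempty := by
    refine ⟨n, X, fun j ↦ C (e : k)⁻¹ * pderiv j w, fun j ↦ ⟨1, one_pos, isHomogeneous_X _ _⟩,
      fun j ↦ ⟨0 + (e - 1), by omega, (isHomogeneous_C _ _).mul hw.pderiv⟩, ?_⟩
    have h : ∑ j, X j * (C (e : k)⁻¹ * pderiv j w) = C (e : k)⁻¹ * ∑ j, X j * pderiv j w := by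
      rw [Finset.mul_sum]
      exact Finset.sum_congr rfl fun j _ ↦ by ring
    rw [h, hw.sum_X_mul_pderiv, nsmul_eq_mul, ← mul_assoc, ← map_natCast (C (σ := Fin n) (R := k)),
      ← C_mul, inv_mul_cancel₀ hchar, C_1, one_mul]
  obtain ⟨g, h, hg, hh, hgh⟩ := Nat.sInf_mem hne
  choose a ha hga using hg
  choose b hb hhb using hh
  obtain ⟨m, hm⟩ := Nat.exists_eq_add_of_le hr
  subst hm
  have hcc : ∀ {c : ℕ} {p : MvPolynomial (Fin n) k}, 0 < c → p.IsHomogeneous c →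
      constantCoeff p = 0 := fun hc hp ↦ by
    rw [constantCoeff_eq, hp.coeff_eq_zero (by simpa using hc.ne)]
  refine ⟨Fin.append (fun i ↦ if a i + b i = e then g i else 0) 0,
    Fin.append (fun i ↦ if a i + b i = e then h i else 0) 0, fun i ↦ ?_, fun i ↦ ?_, ?_⟩
  · refine Fin.addCases (fun i ↦ ?_) (fun i ↦ ?_) i
    · rw [Fin.append_left]
      split_ifs with hi
      · exact ⟨hcc (ha i) (hga i), (hga i).totalDegree_le.trans (by omega)⟩
      · simp
    · simp
  · refine Fin.addCases (fun i ↦ ?_) (fun i ↦ ?_) i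
    · rw [Fin.append_left]
      split_ifs with hi
      · exact ⟨hcc (hb i) (hhb i), (hhb i).totalDegree_le.trans (by omega)⟩
      · simp
    · simp
  · rw [Fin.sum_univ_add]
    simp only [Fin.append_left, Fin.append_right, Pi.zero_apply, mul_zero, Finset.sum_const_zero,
      add_zero]
    have hwe : w = homogeneousComponent e w := by
      rw [homogeneousComponent_of_mem ((mem_homogeneousSubmodule _ _).2 hw), if_pos rfl]
    conv_lhs => rw [hwe, hgh, map_sum]
    refine Finset.sum_congr rfl fun i _ ↦ ?_
    rw [homogeneousComponent_of_mem ((mem_homogeneousSubmodule _ _).2 ((hga i).mul (hhb i)))]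
    by_cases hi : a i + b i = e
    · rw [if_pos hi.symm, if_pos hi, if_pos hi]
    · rw [if_neg (Ne.symm hi), if_neg hi, zero_mul]

/-- Theorem 1.6(i). Let `k` be algebraically closed with
`char k ∤ d(d-1)`, `d ≥ 3`, and `f` a nonzero homogeneous polynomial of degree `d` on `V`.
Then for generic `v` — all `v` in a nonempty Zariski open subset of `V`, i.e. the complement
of the zero locus of some nonzero polynomial `h` — one has
`rk^S(∂_v f) ≥ 2^{2-d} · rk^S(f)`, where `∂_v f = ∑ j, v j • ∂_j f` is the directional
derivative of `f` along `v` (the inequality is written with the factor `2^{d-2}` moved to the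
left-hand side). -/
theorem schmidtRank_dirDeriv_ge_generic {k : Type} [Field k] [IsAlgClosed k] {n d : ℕ}
    (hd : 3 ≤ d) (hchar : ¬ (ringChar k ∣ d * (d - 1)))
    (f : MvPolynomial (Fin n) k) (hf : f ≠ 0) (hhom : f.IsHomogeneous d) :
    ∃ h : MvPolynomial (Fin n) k, h ≠ 0 ∧ ∀ v : Fin n → k, eval v h ≠ 0 →
      polySchmidtRank f ≤ 2 ^ (d - 2) * polySchmidtRank (∑ j, v j • pderiv j f) := by
  have hc : ((d * (d - 1) : ℕ) : k) ≠ 0 := fun h ↦ hchar ((ringChar.spec k _).1 h)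
  have hc' : ((d - 1 : ℕ) : k) ≠ 0 := fun h ↦ hc (by rw [Nat.cast_mul, h, mul_zero])
  by_contra! hcon
  set r := (polySchmidtRank f - 1) / 2 ^ (d - 2) with hr
  obtain ⟨E, _, _, v, g, h, hv, hg, hh, hgh⟩ := exists_generic_decomposition (r := r) (N := d - 1)
    (fun j ↦ pderiv j f)
    {v | 2 ^ (d - 2) * polySchmidtRank (∑ j, v j • pderiv j f) < polySchmidtRank f}
    (fun q hq ↦ (hcon q hq).imp fun v hv ↦ ⟨hv.2, hv.1⟩) (fun v hv ↦ by
      refine exists_decomposition_of_polySchmidtRank_le ?_ (by omega) hc' ?_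
      · refine IsHomogeneous.sum _ _ _ fun j _ ↦ ?_
        rw [smul_eq_C_mul, ← zero_add (d - 1)]
        exact (isHomogeneous_C _ _).mul hhom.pderiv
      · rw [hr, Nat.le_div_iff_mul_le (by positivity), mul_comm]
        exact Nat.le_sub_one_of_lt hv)
  have hle := polySchmidtRank_le_of_algebraicIndependent hd hc hhom hv g h hg hh
    (by simpa only [pderiv_map] using hgh)
  have hpos : 0 < polySchmidtRank f := by
    obtain ⟨v, -, hv⟩ := hcon 1 one_ne_zero
    exact (Nat.zero_le _).trans_lt hv
  have h2 : 2 * (d - 2) ≤ 2 ^ (d - 2) := by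
    obtain ⟨m, hm⟩ := Nat.exists_eq_add_of_le hd
    have h3 : d - 2 = m + 1 := by omega
    rw [h3, pow_succ, mul_comm]
    exact Nat.mul_le_mul_right _ Nat.lt_two_pow_self
  have h4 : r * 2 ^ (d - 2) ≤ polySchmidtRank f - 1 := Nat.div_mul_le_self _ _
  have h5 : 2 * r * (d - 2) ≤ r * 2 ^ (d - 2) := by
    calc 2 * r * (d - 2) = r * (2 * (d - 2)) := by ring
      _ ≤ _ := Nat.mul_le_mul_left _ h2
  omega
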